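/- Suppose z* is a solution of the nonlinear program at which MFCQ and the second-order condition are satisfied, and fix constants C > 0, γ ∈ (0,1). Then there exist K > 0 and a neighborhood W of S such that for every triple (z,λ,s) with (z,λ) ∈ W and λ ≥ 0 for which (z,λ,s) satisfies the approximate centrality conditions with constants C, γ, one has δ(z,λ) ≤ K·μ^{1/2}, where μ = λᵀs/m. -/

import Mathlib

open Matrix
open scoped BigOperators

noncomputable section

attribute [local instance] Classical.propDecidable

/-- Euclidean norm of a finitely indexed family of real numbers. -/
def evnorm {ι : Type*} [Fintype ι] (v : ι → ℝ) : ℝ :=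
  Real.sqrt (∑ i, v i ^ 2)

/-- Frobenius norm of a real matrix. -/
def mnorm {ι κ : Type*} [Fintype ι] [Fintype κ] (M : Matrix ι κ ℝ) : ℝ :=
  Real.sqrt (∑ i, ∑ j, M i j ^ 2)

/-- Smallest singular value of a real matrix. -/
def sigmaMin {ι κ : Type*} [Fintype ι] [Fintype κ] (M : Matrix ι κ ℝ) : ℝ :=
  sInf {t | ∃ x : κ → ℝ, evnorm x = 1 ∧ t = evnorm (M.mulVec x)}

/-- The continuous linear functional `x ↦ ⟨v, x⟩` on `ℝⁿ`. -/
def dotCLM {n : ℕ} (v : Fin n → ℝ) : (Fin n → ℝ) →L[ℝ] ℝ :=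
  ∑ i, v i • (ContinuousLinearMap.proj (R := ℝ) (φ := fun _ : Fin n => ℝ) i)

/-- The continuous linear map `x ↦ M x` on `ℝⁿ`. -/
def matCLM {n : ℕ} (M : Matrix (Fin n) (Fin n) ℝ) : (Fin n → ℝ) →L[ℝ] (Fin n → ℝ) :=
  LinearMap.toContinuousLinearMap (Matrix.toLin' M)

/-- Duality measure `μ(λ,s) = λᵀ s / m`. -/
def dmu {m : ℕ} (lam s : Fin m → ℝ) : ℝ := (∑ i, lam i * s i) / (m : ℝ)

/-- Data of the nonlinear program `min φ(z)  s.t.  g(z) ≤ 0`, with `φ` and each `gᵢ`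
twice Lipschitz continuously differentiable; `gradphi`, `gradg` are the gradients and
`hessphi`, `hessg` the (symmetric) Hessians. -/
structure NLP (n m : ℕ) where
  phi : (Fin n → ℝ) → ℝ
  g : Fin m → (Fin n → ℝ) → ℝ
  gradphi : (Fin n → ℝ) → Fin n → ℝ
  gradg : Fin m → (Fin n → ℝ) → Fin n → ℝ
  hessphi : (Fin n → ℝ) → Matrix (Fin n) (Fin n) ℝ
  hessg : Fin m → (Fin n → ℝ) → Matrix (Fin n) (Fin n) ℝ
  grad_phi : ∀ z, HasFDerivAt phi (dotCLM (gradphi z)) z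
  grad_g : ∀ i z, HasFDerivAt (g i) (dotCLM (gradg i z)) z
  hess_phi : ∀ z, HasFDerivAt gradphi (matCLM (hessphi z)) z
  hess_g : ∀ i z, HasFDerivAt (gradg i) (matCLM (hessg i z)) z
  hessphi_symm : ∀ z, (hessphi z).IsSymm
  hessg_symm : ∀ i z, (hessg i z).IsSymm
  lip_phi : ∃ K, ∀ z z', mnorm (hessphi z - hessphi z') ≤ K * evnorm (z - z')
  lip_g : ∀ i, ∃ K, ∀ z z', mnorm (hessg i z - hessg i z') ≤ K * evnorm (z - z')

namespace NLP

variable {n m : ℕ} (P : NLP n m)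

/-- Gradient of the Lagrangian with respect to `z`:  `L_z(z,λ) = ∇φ(z) + ∇g(z)λ`. -/
def Lz (z : Fin n → ℝ) (lam : Fin m → ℝ) : Fin n → ℝ :=
  fun j => P.gradphi z j + ∑ i, lam i * P.gradg i z j

/-- Hessian of the Lagrangian with respect to `z`. -/
def Lzz (z : Fin n → ℝ) (lam : Fin m → ℝ) : Matrix (Fin n) (Fin n) ℝ :=
  P.hessphi z + ∑ i, lam i • P.hessg i z

/-- The KKT conditions at `(z, λ)`. -/
def KKT (z : Fin n → ℝ) (lam : Fin m → ℝ) : Prop :=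
  P.Lz z lam = 0 ∧ (∀ i, P.g i z ≤ 0) ∧ (∀ i, 0 ≤ lam i) ∧ (∑ i, lam i * P.g i z) = 0

/-- The set `S_λ` of optimal Lagrange multipliers at `z*`. -/
def Slam (zstar : Fin n → ℝ) : Set (Fin m → ℝ) := {lam | P.KKT zstar lam}

/-- The Mangasarian–Fromovitz constraint qualification at `z*`. -/
def MFCQ (zstar : Fin n → ℝ) : Prop :=
  ∃ ybar : Fin n → ℝ, ∀ i, P.g i zstar = 0 → (∑ j, P.gradg i zstar j * ybar j) < 0

/-- The index set `B₊` of active constraints with a positive multiplier. -/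
def BPlus (zstar : Fin n → ℝ) : Set (Fin m) :=
  {i | P.g i zstar = 0 ∧ ∃ ls ∈ P.Slam zstar, 0 < ls i}

/-- The second-order sufficient condition at `z*`. -/
def SOC (zstar : Fin n → ℝ) : Prop :=
  ∃ ξ : ℝ, 0 < ξ ∧ ∀ ls ∈ P.Slam zstar, ∀ w : Fin n → ℝ,
    (∀ i, i ∈ P.BPlus zstar → (∑ j, P.gradg i zstar j * w j) = 0) →
    (∀ i, P.g i zstar = 0 → i ∉ P.BPlus zstar → (∑ j, P.gradg i zstar j * w j) ≤ 0) →
    ξ * evnorm w ^ 2 ≤ w ⬝ᵥ (P.Lzz zstar ls).mulVec w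

/-- The strict complementarity condition `B₊ = B` at `z*`. -/
def StrictComp (zstar : Fin n → ℝ) : Prop :=
  ∀ i, P.g i zstar = 0 → i ∈ P.BPlus zstar

/-- `z*` is a solution of the nonlinear program: it is feasible, it is a local
minimizer, and the first-order KKT conditions hold there. -/
def isSolution (zstar : Fin n → ℝ) : Prop :=
  (∀ i, P.g i zstar ≤ 0) ∧ (∃ lam, P.KKT zstar lam) ∧
  ∀ᶠ z in nhds zstar, (∀ i, P.g i z ≤ 0) → P.phi zstar ≤ P.phi z

/-- Euclidean distance `δ(z,λ)` from `(z,λ)` to the primal–dual solution set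
`S = {z*} × S_λ`. -/
def delta (zstar z : Fin n → ℝ) (lam : Fin m → ℝ) : ℝ :=
  sInf {d | ∃ ls ∈ P.Slam zstar,
    d = Real.sqrt (evnorm (z - zstar) ^ 2 + evnorm (lam - ls) ^ 2)}

/-- The approximate centrality conditions with constants `C`, `γ`. -/
def central (C gam : ℝ) (z : Fin n → ℝ) (lam s : Fin m → ℝ) : Prop :=
  evnorm (P.Lz z lam) ≤ C * dmu lam s ∧
  evnorm (fun i => P.g i z + s i) ≤ C * dmu lam s ∧
  (∀ i, 0 < lam i) ∧ (∀ i, 0 < s i) ∧ (∀ i, gam * dmu lam s ≤ lam i * s i)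

/-- The active index set `B` at `z*`, as a type. -/
abbrev Bsub (zstar : Fin n → ℝ) : Type := {i : Fin m // P.g i zstar = 0}

/-- The inactive index set `N` at `z*`, as a type. -/
abbrev Nsub (zstar : Fin n → ℝ) : Type := {i : Fin m // ¬ P.g i zstar = 0}

/-- `∇g(z)`:  the `n × m` matrix whose columns are the constraint gradients. -/
def Gfull (z : Fin n → ℝ) : Matrix (Fin n) (Fin m) ℝ :=
  Matrix.of fun j i => P.gradg i z j

/-- `∇g_B(z)`:  the columns of `∇g(z)` indexed by the active set `B` at `z*`. -/
def GB (zstar z : Fin n → ℝ) : Matrix (Fin n) (P.Bsub zstar) ℝ :=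
  Matrix.of fun j b => P.gradg b.1 z j

/-- `∇g_N(z)`:  the columns of `∇g(z)` indexed by the inactive set `N` at `z*`. -/
def GN (zstar z : Fin n → ℝ) : Matrix (Fin n) (P.Nsub zstar) ℝ :=
  Matrix.of fun j b => P.gradg b.1 z j

/-- The diagonal matrix `D_B = Λ_B⁻¹ S_B`. -/
def DB (zstar : Fin n → ℝ) (lam s : Fin m → ℝ) :
    Matrix (P.Bsub zstar) (P.Bsub zstar) ℝ :=
  Matrix.diagonal fun b => s b.1 / lam b.1

/-- The diagonal matrix `D_N = Λ_N⁻¹ S_N`. -/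
def DN (zstar : Fin n → ℝ) (lam s : Fin m → ℝ) :
    Matrix (P.Nsub zstar) (P.Nsub zstar) ℝ :=
  Matrix.diagonal fun b => s b.1 / lam b.1

/-- The exact primal–dual step: the solution of the linear system (pdip.orig). -/
def exactStep (z : Fin n → ℝ) (lam s t : Fin m → ℝ) (dz : Fin n → ℝ)
    (dl ds : Fin m → ℝ) : Prop :=
  (∀ j, ((P.Lzz z lam).mulVec dz) j + ((P.Gfull z).mulVec dl) j = -(P.Lz z lam j)) ∧
  (∀ i, (((P.Gfull z)ᵀ).mulVec dz) i + ds i = -(P.g i z + s i)) ∧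
  (∀ i, s i * dl i + lam i * ds i = -(s i * lam i + t i))

end NLP

/-- Part (a) of Assumption A: `z*` is a solution at which MFCQ, the second-order
condition, and strict complementarity hold, and the current iterate `(z,λ,s)`
satisfies the approximate centrality conditions with constants `C`, `γ`. -/
def AssumptionAa {n m : ℕ} (P : NLP n m) (zstar : Fin n → ℝ) (C gam : ℝ)
    (z : Fin n → ℝ) (lam s : Fin m → ℝ) : Prop :=
  P.isSolution zstar ∧ P.MFCQ zstar ∧ P.SOC zstar ∧ P.StrictComp zstar ∧
  P.central C gam z lam s

/-- The data of a singular value decomposition `∇g_B(z*) = Û Σ Uᵀ`, where the square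
matrices `[Û V̂]` (of order `n`) and `[U V]` (of order `|B|`) are orthogonal and `Σ` is
diagonal with positive diagonal entries. -/
structure SVDdata {n m : ℕ} (P : NLP n m) (zstar : Fin n → ℝ) where
  k : ℕ
  kc : ℕ
  r : ℕ
  Uhat : Matrix (Fin n) (Fin k) ℝ
  Vhat : Matrix (Fin n) (Fin kc) ℝ
  U : Matrix (P.Bsub zstar) (Fin k) ℝ
  V : Matrix (P.Bsub zstar) (Fin r) ℝ
  sig : Fin k → ℝ
  sig_pos : ∀ j, 0 < sig j
  hUhat : Uhatᵀ * Uhat = 1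
  hVhat : Vhatᵀ * Vhat = 1
  hUVhat : Uhatᵀ * Vhat = 0
  hhat_complete : Uhat * Uhatᵀ + Vhat * Vhatᵀ = 1
  hU : Uᵀ * U = 1
  hV : Vᵀ * V = 1
  hUV : Uᵀ * V = 0
  h_complete : U * Uᵀ + V * Vᵀ = 1
  hsvd : P.GB zstar zstar = Uhat * Matrix.diagonal sig * Uᵀ

section ErrorBound

open Set Filter Topology

lemma exists_norm_le_mul_norm_of_cone {E F : Type*} [NormedAddCommGroup E] [NormedSpace ℝ E]
    [FiniteDimensional ℝ E] [NormedAddCommGroup F] [NormedSpace ℝ F] (A : E →L[ℝ] F)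
    (S : Set E) (hS : IsClosed S) (hcone : ∀ c : ℝ, 0 ≤ c → ∀ x ∈ S, c • x ∈ S)
    (hker : ∀ x ∈ S, A x = 0 → x = 0) :
    ∃ K : ℝ, 0 ≤ K ∧ ∀ x ∈ S, ‖x‖ ≤ K * ‖A x‖ := by
  have hnorm : ∀ x ∈ S, x ≠ 0 → ‖x‖⁻¹ • x ∈ S ∩ Metric.sphere 0 1 := fun x hx hx0 =>
    ⟨hcone _ (by positivity) x hx, by simp [norm_smul, hx0]⟩
  have hcomp : IsCompact (S ∩ Metric.sphere (0 : E) 1) :=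
    (isCompact_sphere 0 1).inter_left hS
  rcases (S ∩ Metric.sphere (0 : E) 1).eq_empty_or_nonempty with he | hne
  · refine ⟨0, le_rfl, fun x hx => ?_⟩
    have : x = 0 := by
      by_contra hx0
      have := hnorm x hx hx0
      rw [he] at this
      exact this
    simp [this]
  · obtain ⟨y, ⟨hyS, hy1⟩, hmin⟩ :=
      hcomp.exists_isMinOn hne (f := fun x => ‖A x‖) (by fun_prop)
    have hypos : 0 < ‖A y‖ := norm_pos_iff.2 fun h => by
      have := hker y hyS h
      simp [this] at hy1
    refine ⟨‖A y‖⁻¹, by positivity, fun x hx => ?_⟩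
    by_cases hx0 : x = 0
    · simp [hx0]
    have hxpos : 0 < ‖x‖ := norm_pos_iff.2 hx0
    have h1 : ‖A y‖ ≤ ‖A (‖x‖⁻¹ • x)‖ := hmin (hnorm x hx hx0)
    rw [map_smul, norm_smul, norm_inv, norm_norm] at h1
    rw [inv_mul_eq_div, le_div_iff₀ hypos]
    calc ‖x‖ * ‖A y‖ ≤ ‖x‖ * (‖x‖⁻¹ * ‖A x‖) := by gcongr
      _ = ‖A x‖ := by field_simp

/-- The closed orthant of vectors whose signs are prescribed by `σ`. -/
def signOrthant {ι : Type*} (σ : ι → SignType) : Set (ι → ℝ) :=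
  {p | ∀ i, 0 ≤ (σ i : ℝ) * p i ∧ (σ i = 0 → p i = 0)}

lemma isClosed_signOrthant {ι : Type*} (σ : ι → SignType) : IsClosed (signOrthant σ) := by
  have : signOrthant σ = ⋂ i, ({p | 0 ≤ (σ i : ℝ) * p i} ∩ {p | σ i = 0 → p i = 0}) := by
    ext p; simp [signOrthant]
  rw [this]
  refine isClosed_iInter fun i => IsClosed.inter (isClosed_le (by fun_prop) (by fun_prop)) ?_
  by_cases h : σ i = 0
  · simpa [h] using isClosed_eq (by fun_prop : Continuous fun p : ι → ℝ => p i) continuous_const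
  · simp [h]

lemma ker_inter_signOrthant_eq_zero_of_isMinOn {ι F : Type*} [Fintype ι]
    [NormedAddCommGroup F] [NormedSpace ℝ F] (A : (ι → ℝ) →L[ℝ] F) (v p : ι → ℝ)
    (hA : A p = A v) (hp : ∀ i, p i ∈ uIcc 0 (v i))
    (hmin : ∀ q : ι → ℝ, A q = A v → (∀ i, q i ∈ uIcc 0 (v i)) → ∑ i, |p i| ≤ ∑ i, |q i|)
    (u : ι → ℝ) (hu : u ∈ signOrthant fun i => SignType.sign (p i)) (hAu : A u = 0) : u = 0 := by
  have hev : ∀ᶠ t : ℝ in 𝓝[>] 0, ∀ i, p i - t * u i ∈ uIcc 0 (p i) ∧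
      |p i - t * u i| = |p i| - t * |u i| := by
    refine eventually_all.2 fun i => ?_
    obtain ⟨h1, h2⟩ := hu i
    dsimp only at h1 h2
    have hlim : Tendsto (fun t : ℝ => t * u i) (𝓝[>] 0) (𝓝 0) := by
      have : Tendsto (fun t : ℝ => t * u i) (𝓝 0) (𝓝 (0 * u i)) :=
        (continuous_id.mul continuous_const).tendsto 0
      rw [zero_mul] at this
      exact this.mono_left nhdsWithin_le_nhds
    rcases lt_trichotomy (p i) 0 with hpi | hpi | hpi
    · rw [sign_neg hpi] at h1
      have hui : u i ≤ 0 := by simpa using h1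
      filter_upwards [hlim.eventually_const_lt hpi, self_mem_nhdsWithin] with t ht ht0
      have ht0 : 0 < t := ht0
      have : t * u i ≤ 0 := mul_nonpos_of_nonneg_of_nonpos ht0.le hui
      rw [uIcc_of_ge hpi.le, abs_of_nonpos (by linarith), abs_of_neg hpi, abs_of_nonpos hui]
      exact ⟨⟨by linarith, by linarith⟩, by ring⟩
    · have hui : u i = 0 := h2 (by simp [hpi])
      simp [hpi, hui]
    · rw [sign_pos hpi] at h1
      have hui : 0 ≤ u i := by simpa using h1
      filter_upwards [hlim.eventually_lt_const hpi, self_mem_nhdsWithin] with t ht ht0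
      have ht0 : 0 < t := ht0
      have : 0 ≤ t * u i := mul_nonneg ht0.le hui
      rw [uIcc_of_le hpi.le, abs_of_nonneg (by linarith), abs_of_pos hpi, abs_of_nonneg hui]
      exact ⟨⟨by linarith, by linarith⟩, by ring⟩
  obtain ⟨t, ht, ht0⟩ := (hev.and self_mem_nhdsWithin).exists
  have ht0 : 0 < t := ht0
  have hle := hmin (p - t • u) (by rw [map_sub, map_smul, hAu, smul_zero, sub_zero, hA])
    fun i => uIcc_subset_uIcc left_mem_uIcc (hp i) (ht i).1
  have heq : ∑ i, |(p - t • u) i| = ∑ i, |p i| - t * ∑ i, |u i| := by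
    rw [Finset.mul_sum, ← Finset.sum_sub_distrib]
    exact Finset.sum_congr rfl fun i _ => (ht i).2
  have hsum : ∑ i, |u i| ≤ 0 := by
    rw [heq] at hle
    by_contra! h
    nlinarith
  funext i
  have := (Finset.sum_eq_zero_iff_of_nonneg fun i _ => abs_nonneg (u i)).1
    (le_antisymm hsum (Finset.sum_nonneg fun i _ => abs_nonneg (u i))) i (Finset.mem_univ i)
  simpa using this

lemma exists_conformal_preimage_norm_le {ι F : Type*} [Fintype ι]
    [NormedAddCommGroup F] [NormedSpace ℝ F] (A : (ι → ℝ) →L[ℝ] F) :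
    ∃ K : ℝ, 0 ≤ K ∧ ∀ v : ι → ℝ, ∃ p : ι → ℝ, A p = A v ∧ (∀ i, p i ∈ uIcc 0 (v i)) ∧
      ‖p‖ ≤ K * ‖A v‖ := by
  have hσ : ∀ σ : ι → SignType, ∃ K : ℝ, 0 ≤ K ∧
      ((∀ u ∈ signOrthant σ, A u = 0 → u = 0) → ∀ u ∈ signOrthant σ, ‖u‖ ≤ K * ‖A u‖) := by
    intro σ
    by_cases h : ∀ u ∈ signOrthant σ, A u = 0 → u = 0
    · obtain ⟨K, hK, hb⟩ := exists_norm_le_mul_norm_of_cone A _ (isClosed_signOrthant σ)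
        (fun c hc x hx i => ⟨by
          have := mul_nonneg hc (hx i).1
          simp only [Pi.smul_apply, smul_eq_mul]
          linarith, fun h0 => by simp [(hx i).2 h0]⟩) h
      exact ⟨K, hK, fun _ => hb⟩
    · exact ⟨0, le_rfl, fun h' => absurd h' h⟩
  choose Kσ hK0 hK using hσ
  refine ⟨∑ σ, Kσ σ, Finset.sum_nonneg fun σ _ => hK0 σ, fun v => ?_⟩
  have hcomp : IsCompact ({p : ι → ℝ | A p = A v} ∩ Set.univ.pi fun i => uIcc 0 (v i)) :=
    (isCompact_univ_pi fun i => isCompact_uIcc).inter_left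
      (isClosed_eq A.continuous continuous_const)
  obtain ⟨p, ⟨hpA, hp⟩, hmin⟩ := hcomp.exists_isMinOn
    ⟨v, rfl, fun i _ => right_mem_uIcc⟩ (f := fun p => ∑ i, |p i|) (by fun_prop)
  have hp : ∀ i, p i ∈ uIcc 0 (v i) := fun i => hp i (Set.mem_univ i)
  have hpA : A p = A v := hpA
  refine ⟨p, hpA, hp, ?_⟩
  have hb := hK (fun i => SignType.sign (p i))
    (fun u hu hAu => ker_inter_signOrthant_eq_zero_of_isMinOn A v p hpA hp
      (fun q hq hq' => hmin ⟨hq, fun i _ => hq' i⟩) u hu hAu) p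
    (fun i => ⟨by rw [sign_mul_self]; exact abs_nonneg _, fun h => sign_eq_zero_iff.1 h⟩)
  rw [hpA] at hb
  exact hb.trans (mul_le_mul_of_nonneg_right
    (Finset.single_le_sum (fun σ _ => hK0 σ) (Finset.mem_univ _)) (norm_nonneg _))

/-- The Hoffman error bound for a polyhedron in standard form. -/
lemma hoffman_standard_form {ι F : Type*} [Fintype ι] [NormedAddCommGroup F] [NormedSpace ℝ F]
    (A : (ι → ℝ) →L[ℝ] F) (b : F) (hne : ∃ q : ι → ℝ, (∀ i, 0 ≤ q i) ∧ A q = b) :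
    ∃ K : ℝ, 0 ≤ K ∧ ∀ x : ι → ℝ, (∀ i, 0 ≤ x i) →
      ∃ q : ι → ℝ, (∀ i, 0 ≤ q i) ∧ A q = b ∧ ‖x - q‖ ≤ K * ‖A x - b‖ := by
  obtain ⟨q₀, hq₀, rfl⟩ := hne
  obtain ⟨K, hK, h⟩ := exists_conformal_preimage_norm_le A
  refine ⟨K, hK, fun x hx => ?_⟩
  obtain ⟨p, hpA, hp, hb⟩ := h (q₀ - x)
  refine ⟨x + p, fun i => ?_, by rw [map_add, hpA, map_sub]; abel, ?_⟩
  · have h1 := (hp i).1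
    have h2 := hx i
    have h3 := hq₀ i
    simp only [Pi.sub_apply] at h1
    rcases min_le_iff.1 h1 with h | h <;> simp only [Pi.add_apply] <;> linarith
  · rwa [sub_add_cancel_left, norm_neg, norm_sub_rev, ← map_sub]

lemma abs_le_evnorm {ι : Type*} [Fintype ι] (v : ι → ℝ) (i : ι) : |v i| ≤ evnorm v :=
  Real.abs_le_sqrt
    (Finset.single_le_sum (f := fun i => v i ^ 2) (fun _ _ => sq_nonneg _) (Finset.mem_univ i))

lemma evnorm_le_sqrt_card_mul_norm {ι : Type*} [Fintype ι] (v : ι → ℝ) :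
    evnorm v ≤ √(Fintype.card ι) * ‖v‖ := by
  refine Real.sqrt_le_iff.2 ⟨by positivity, ?_⟩
  rw [mul_pow, Real.sq_sqrt (Nat.cast_nonneg _), ← nsmul_eq_mul]
  refine Finset.sum_le_card_nsmul _ _ _ fun i _ => ?_
  rw [← sq_abs]
  exact pow_le_pow_left₀ (abs_nonneg _) (norm_le_pi_norm v i) 2

lemma dotCLM_apply {n : ℕ} (v x : Fin n → ℝ) : dotCLM v x = v ⬝ᵥ x := by
  simp [dotCLM, dotProduct]

lemma abs_dotProduct_le {n : ℕ} (v x : Fin n → ℝ) {a b : ℝ} (hv : ∀ i, |v i| ≤ a)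
    (hx : ∀ i, |x i| ≤ b) : |v ⬝ᵥ x| ≤ n * (a * b) := by
  calc |v ⬝ᵥ x| ≤ ∑ i, |v i * x i| := Finset.abs_sum_le_sum_abs _ _
    _ ≤ ∑ _i : Fin n, a * b := Finset.sum_le_sum fun i _ => by
        rw [abs_mul]
        exact mul_le_mul (hv i) (hx i) (abs_nonneg _) ((abs_nonneg _).trans (hv i))
    _ = n * (a * b) := by simp

lemma norm_dotCLM_sub_le {n : ℕ} (v v' : Fin n → ℝ) :
    ‖dotCLM v - dotCLM v'‖ ≤ n * ‖v - v'‖ := by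
  refine ContinuousLinearMap.opNorm_le_bound _ (by positivity) fun x => ?_
  rw [_root_.sub_apply, dotCLM_apply, dotCLM_apply, ← sub_dotProduct, mul_assoc]
  exact abs_dotProduct_le _ _ (fun i => norm_le_pi_norm (v - v') i) fun i => norm_le_pi_norm x i

lemma exists_abs_taylor_remainder_le {n : ℕ} {f : (Fin n → ℝ) → ℝ}
    {f' : (Fin n → ℝ) → Fin n → ℝ} {f'' : (Fin n → ℝ) →L[ℝ] (Fin n → ℝ)} {a : Fin n → ℝ}
    (hf : ∀ z, HasFDerivAt f (dotCLM (f' z)) z) (hf' : HasFDerivAt f' f'' a) :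
    ∃ M : ℝ, ∀ᶠ z in 𝓝 a, |f z - f a - f' a ⬝ᵥ (z - a)| ≤ M * ‖z - a‖ ^ 2 := by
  obtain ⟨c, hc, hb⟩ := hf'.isBigO_sub.exists_pos
  obtain ⟨ε, hε, hball⟩ := Metric.eventually_nhds_iff_ball.1 hb.bound
  refine ⟨n * c, Metric.eventually_nhds_iff_ball.2 ⟨ε, hε, fun z hz => ?_⟩⟩
  have key := (convex_closedBall a ‖z - a‖).norm_image_sub_le_of_norm_hasFDerivWithin_le'
    (f := f) (f' := fun y => dotCLM (f' y)) (φ := dotCLM (f' a)) (C := n * (c * ‖z - a‖))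
    (x := a) (y := z) (fun y _ => (hf y).hasFDerivWithinAt) (fun y hy => ?_)
    (Metric.mem_closedBall_self (norm_nonneg _)) (by simp [dist_eq_norm])
  · rw [dotCLM_apply, Real.norm_eq_abs] at key
    linarith
  · have hy' : ‖y - a‖ ≤ ‖z - a‖ := by simpa [dist_eq_norm] using hy
    have hyε : y ∈ Metric.ball a ε := by
      rw [Metric.mem_ball, dist_eq_norm] at hz ⊢
      exact hy'.trans_lt hz
    calc ‖dotCLM (f' y) - dotCLM (f' a)‖ ≤ n * ‖f' y - f' a‖ := norm_dotCLM_sub_le _ _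
      _ ≤ n * (c * ‖z - a‖) := by
        gcongr
        exact (hball y hyε).trans (by gcongr)

lemma HasFDerivAt.tendsto_inv_norm_smul_sub {E F : Type*} [NormedAddCommGroup E]
    [NormedSpace ℝ E] [NormedAddCommGroup F] [NormedSpace ℝ F] {f : E → F} {f' : E →L[ℝ] F}
    {a d : E} (hf : HasFDerivAt f f' a) {z : ℕ → E} (hz : Tendsto z atTop (𝓝 a))
    (hd : Tendsto (fun k => ‖z k - a‖⁻¹ • (z k - a)) atTop (𝓝 d)) :
    Tendsto (fun k => ‖z k - a‖⁻¹ • (f (z k) - f a)) atTop (𝓝 (f' d)) := by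
  have h := (hasFDerivWithinAt_univ.2 hf).lim (c := fun k => ‖z k - a‖⁻¹)
    (d := fun k => z k - a) (by simpa using hz.sub_const a) (by simp) hd
  simpa using h

namespace NLP

variable {n m : ℕ} (P : NLP n m)

lemma Lz_dotProduct (z : Fin n → ℝ) (lam : Fin m → ℝ) (d : Fin n → ℝ) :
    P.Lz z lam ⬝ᵥ d = P.gradphi z ⬝ᵥ d + ∑ i, lam i * (P.gradg i z ⬝ᵥ d) := by
  have : P.Lz z lam = P.gradphi z + ∑ i, lam i • P.gradg i z := by
    ext j; simp [Lz]
  rw [this, add_dotProduct, sum_dotProduct]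
  simp

lemma dotProduct_Lzz_mulVec (z : Fin n → ℝ) (lam : Fin m → ℝ) (d : Fin n → ℝ) :
    d ⬝ᵥ (P.Lzz z lam) *ᵥ d =
      d ⬝ᵥ P.hessphi z *ᵥ d + ∑ i, lam i * (d ⬝ᵥ P.hessg i z *ᵥ d) := by
  simp [Lzz, add_mulVec, sum_mulVec, smul_mulVec, dotProduct_add, dotProduct_sum]

variable {P}

lemma KKT.mul_eq_zero {z : Fin n → ℝ} {lam : Fin m → ℝ} (h : P.KKT z lam) (i : Fin m) :
    lam i * P.g i z = 0 :=
  (Finset.sum_eq_zero_iff_of_nonpos fun i _ =>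
    mul_nonpos_of_nonneg_of_nonpos (h.2.2.1 i) (h.2.1 i)).1 h.2.2.2 i (Finset.mem_univ i)

section central

variable {C gam : ℝ} {z : Fin n → ℝ} {lam s : Fin m → ℝ}

lemma central.dmu_nonneg (h : P.central C gam z lam s) : 0 ≤ dmu lam s :=
  div_nonneg (Finset.sum_nonneg fun i _ => (mul_pos (h.2.2.1 i) (h.2.2.2.1 i)).le)
    (Nat.cast_nonneg _)

lemma sum_mul_eq_card_mul_dmu (lam s : Fin m → ℝ) : ∑ i, lam i * s i = m * dmu lam s := by
  rcases Nat.eq_zero_or_pos m with rfl | hm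
  · simp
  · have : (m : ℝ) ≠ 0 := by positivity
    rw [dmu]
    field_simp

lemma central.mul_le (h : P.central C gam z lam s) (i : Fin m) :
    lam i * s i ≤ m * dmu lam s := by
  rw [← sum_mul_eq_card_mul_dmu]
  exact Finset.single_le_sum (f := fun i => lam i * s i)
    (fun i _ => (mul_pos (h.2.2.1 i) (h.2.2.2.1 i)).le) (Finset.mem_univ i)

lemma central.abs_Lz_le (h : P.central C gam z lam s) (j : Fin n) :
    |P.Lz z lam j| ≤ C * dmu lam s :=
  (abs_le_evnorm _ j).trans h.1

lemma central.abs_g_add_le (h : P.central C gam z lam s) (i : Fin m) :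
    |P.g i z + s i| ≤ C * dmu lam s :=
  (abs_le_evnorm (fun i => P.g i z + s i) i).trans h.2.1

lemma central.mul_g_ge (h : P.central C gam z lam s) (i : Fin m) :
    -(m * dmu lam s + lam i * (C * dmu lam s)) ≤ lam i * P.g i z := by
  have h1 := mul_le_mul_of_nonneg_left (abs_le.1 (h.abs_g_add_le i)).1 (h.2.2.1 i).le
  have h2 := h.mul_le i
  linarith

lemma central.g_le (h : P.central C gam z lam s) (i : Fin m) :
    P.g i z ≤ C * dmu lam s := by
  have h1 := (abs_le.1 (h.abs_g_add_le i)).2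
  have h2 := h.2.2.2.1 i
  linarith

lemma central.multiplier_sub_mul_g_sub_ge (h : P.central C gam z lam s) {zstar : Fin n → ℝ}
    {ls : Fin m → ℝ} (hls : P.KKT zstar ls) (i : Fin m) :
    -((m + C * (lam i + ls i)) * dmu lam s) ≤ (lam i - ls i) * (P.g i z - P.g i zstar) := by
  have h1 := h.mul_g_ge i
  have h2 := mul_le_mul_of_nonneg_left (h.g_le i) (hls.2.2.1 i)
  have h3 := hls.mul_eq_zero i
  have h4 := mul_nonpos_of_nonneg_of_nonpos (h.2.2.1 i).le (hls.2.1 i)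
  linarith

end central

lemma false_of_central_seq {zstar : Fin n → ℝ} {ls : Fin m → ℝ}
    (hls : ls ∈ P.Slam zstar) (hsoc : P.SOC zstar) {C gam : ℝ}
    {z : ℕ → Fin n → ℝ} {lam s : ℕ → Fin m → ℝ} {d : Fin n → ℝ}
    (hz : Tendsto z atTop (𝓝 zstar)) (hlam : Tendsto lam atTop (𝓝 ls))
    (hcen : ∀ k, P.central C gam (z k) (lam k) (s k)) (hpos : ∀ k, 0 < ‖z k - zstar‖)
    (hd : Tendsto (fun k => ‖z k - zstar‖⁻¹ • (z k - zstar)) atTop (𝓝 d))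
    (hmu : Tendsto (fun k => √(dmu (lam k) (s k)) / ‖z k - zstar‖) atTop (𝓝 0)) : False := by
  have hKKT : P.KKT zstar ls := hls
  set t : ℕ → ℝ := fun k => ‖z k - zstar‖ with ht
  set μ : ℕ → ℝ := fun k => dmu (lam k) (s k) with hμ
  have hμ0 : ∀ k, 0 ≤ μ k := fun k => (hcen k).dmu_nonneg
  have ht0 : Tendsto t atTop (𝓝 0) := by
    simpa using (hz.sub_const zstar).norm
  have hμt2 : Tendsto (fun k => μ k / t k ^ 2) atTop (𝓝 0) := by
    have := hmu.pow 2
    rw [zero_pow two_ne_zero] at this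
    refine this.congr fun k => ?_
    rw [div_pow, Real.sq_sqrt (hμ0 k)]
  have hμt : Tendsto (fun k => μ k / t k) atTop (𝓝 0) := by
    have := hμt2.mul ht0
    rw [zero_mul] at this
    refine this.congr fun k => ?_
    have := (hpos k).ne'
    field_simp
  have hlam_i : ∀ i, Tendsto (fun k => lam k i) atTop (𝓝 (ls i)) := tendsto_pi_nhds.1 hlam
  have hd1 : ‖d‖ = 1 := by
    refine tendsto_nhds_unique hd.norm (tendsto_const_nhds.congr fun k => ?_)
    rw [norm_smul, norm_inv, norm_norm, inv_mul_cancel₀ (hpos k).ne']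
  have hg : ∀ i, Tendsto (fun k => (t k)⁻¹ * (P.g i (z k) - P.g i zstar)) atTop
      (𝓝 (P.gradg i zstar ⬝ᵥ d)) := fun i => by
    rw [← dotCLM_apply]
    exact (P.grad_g i zstar).tendsto_inv_norm_smul_sub hz hd
  have hactive_le : ∀ i, P.g i zstar = 0 → P.gradg i zstar ⬝ᵥ d ≤ 0 := by
    intro i hi
    have hlim : Tendsto (fun k => C * (μ k / t k)) atTop (𝓝 0) := by
      simpa using hμt.const_mul C
    refine le_of_tendsto_of_tendsto' (hg i) hlim fun k => ?_
    rw [hi, sub_zero, ← mul_div_assoc, inv_mul_eq_div]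
    exact div_le_div_of_nonneg_right ((hcen k).g_le i) (hpos k).le
  have hcompl : ∀ i, ls i * (P.gradg i zstar ⬝ᵥ d) = 0 := by
    intro i
    rcases mul_eq_zero.1 (hKKT.mul_eq_zero i) with h0 | hi
    · rw [h0, zero_mul]
    · refine le_antisymm (mul_nonpos_of_nonneg_of_nonpos (hKKT.2.2.1 i) (hactive_le i hi)) ?_
      have hlim : Tendsto (fun k => -((m + lam k i * C) * (μ k / t k))) atTop (𝓝 0) := by
        simpa using ((((hlam_i i).mul_const C).const_add (m : ℝ)).mul hμt).neg
      refine le_of_tendsto_of_tendsto' hlim ((hlam_i i).mul (hg i)) fun k => ?_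
      have h1 := div_le_div_of_nonneg_right ((hcen k).mul_g_ge i) (hpos k).le
      rw [hi, sub_zero, inv_mul_eq_div, ← mul_div_assoc, ← mul_div_assoc]
      refine le_of_eq_of_le ?_ h1
      rw [← neg_div]
      congr 1
      ring
  have hphi : P.gradphi zstar ⬝ᵥ d = 0 := by
    have := P.Lz_dotProduct zstar ls d
    rw [hKKT.1, zero_dotProduct, Finset.sum_eq_zero fun i _ => hcompl i] at this
    linarith
  have hBPlus : ∀ i ∈ P.BPlus zstar, P.gradg i zstar ⬝ᵥ d = 0 := by
    rintro i ⟨_, l, hl, hli⟩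
    have hl : P.KKT zstar l := hl
    have hsum := P.Lz_dotProduct zstar l d
    rw [hl.1, zero_dotProduct, hphi, zero_add] at hsum
    have hterm : ∀ j ∈ Finset.univ, l j * (P.gradg j zstar ⬝ᵥ d) ≤ 0 := fun j _ => by
      rcases mul_eq_zero.1 (hl.mul_eq_zero j) with h0 | hj
      · rw [h0, zero_mul]
      · exact mul_nonpos_of_nonneg_of_nonpos (hl.2.2.1 j) (hactive_le j hj)
    have := (Finset.sum_eq_zero_iff_of_nonpos hterm).1 hsum.symm i (Finset.mem_univ i)
    exact (mul_eq_zero.1 this).resolve_left hli.ne'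
  obtain ⟨ξ, hξ, hξb⟩ := hsoc
  have hquad_ge := hξb ls hls d hBPlus fun i hi _ => hactive_le i hi
  have hquad_le : d ⬝ᵥ (P.Lzz zstar ls) *ᵥ d ≤ 0 := by
    choose M hM using fun i =>
      exists_abs_taylor_remainder_le (P.grad_g i) (P.hess_g i zstar)
    have hdot : ∀ {u : ℕ → Fin n → ℝ} {v : Fin n → ℝ}, Tendsto u atTop (𝓝 v) →
        Tendsto (fun k => ((t k)⁻¹ • (z k - zstar)) ⬝ᵥ u k) atTop (𝓝 (d ⬝ᵥ v)) := fun hu =>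
      ((continuous_fst.dotProduct continuous_snd).tendsto (d, _)).comp (hd.prodMk_nhds hu)
    have hlhs : Tendsto (fun k =>
        ((t k)⁻¹ • (z k - zstar)) ⬝ᵥ ((t k)⁻¹ • (P.gradphi (z k) - P.gradphi zstar)) +
        ∑ i, lam k i * (((t k)⁻¹ • (z k - zstar)) ⬝ᵥ
          ((t k)⁻¹ • (P.gradg i (z k) - P.gradg i zstar)))) atTop
        (𝓝 (d ⬝ᵥ (P.Lzz zstar ls) *ᵥ d)) := by
      rw [dotProduct_Lzz_mulVec]
      exact (hdot ((P.hess_phi zstar).tendsto_inv_norm_smul_sub hz hd)).add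
        (tendsto_finsetSum _ fun i _ => (hlam_i i).mul
          (hdot ((P.hess_g i zstar).tendsto_inv_norm_smul_sub hz hd)))
    have hrhs : Tendsto (fun k => n * C * (μ k / t k) +
        ∑ i, ((m + C * (lam k i + ls i)) * (μ k / t k ^ 2) + |lam k i - ls i| * M i)) atTop
        (𝓝 0) := by
      have hterm : ∀ i, Tendsto (fun k =>
          (m + C * (lam k i + ls i)) * (μ k / t k ^ 2) + |lam k i - ls i| * M i) atTop
          (𝓝 0) := fun i => by
        have h1 := ((((hlam_i i).add_const (ls i)).const_mul C).const_add (m : ℝ)).mul hμt2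
        have h2 := (((hlam_i i).sub_const (ls i)).abs).mul_const (M i)
        simpa using h1.add h2
      simpa using (hμt.const_mul (n * C)).add (tendsto_finsetSum Finset.univ fun i _ => hterm i)
    refine le_of_tendsto_of_tendsto hlhs hrhs ?_
    filter_upwards [eventually_all.2 fun i => hz.eventually (hM i)] with k hk
    have htk : 0 < t k := hpos k
    have hL := (abs_le.1 (abs_dotProduct_le (P.Lz (z k) (lam k)) (z k - zstar)
      (hcen k).abs_Lz_le fun i => norm_le_pi_norm (z k - zstar) i)).2
    have hLs : P.Lz zstar ls ⬝ᵥ (z k - zstar) = 0 := by rw [hKKT.1, zero_dotProduct]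
    rw [Lz_dotProduct] at hL hLs
    have hi : ∀ i, -((m + C * (lam k i + ls i)) * μ k + |lam k i - ls i| * M i * t k ^ 2) ≤
        (lam k i - ls i) * (P.gradg i zstar ⬝ᵥ (z k - zstar)) := fun i => by
      have h1 := (hcen k).multiplier_sub_mul_g_sub_ge hKKT i
      have h2 : |(lam k i - ls i) * (P.g i (z k) - P.g i zstar -
          P.gradg i zstar ⬝ᵥ (z k - zstar))| ≤ |lam k i - ls i| * (M i * t k ^ 2) := by
        rw [abs_mul]
        exact mul_le_mul_of_nonneg_left (hk i) (abs_nonneg _)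
      have h3 := (abs_le.1 h2).2
      linarith
    have hsum := Finset.sum_le_sum fun i (_ : i ∈ Finset.univ) => hi i
    rw [← mul_le_mul_iff_left₀ (pow_pos htk 2), add_mul, add_mul, Finset.sum_mul, Finset.sum_mul]
    have e1 : ∀ v : Fin n → ℝ, ((t k)⁻¹ • (z k - zstar)) ⬝ᵥ ((t k)⁻¹ • v) * t k ^ 2 =
        v ⬝ᵥ (z k - zstar) := fun v => by
      rw [smul_dotProduct, dotProduct_smul, smul_eq_mul, smul_eq_mul, dotProduct_comm]
      field_simp
    have e2 : ∀ i, ((m + C * (lam k i + ls i)) * (μ k / t k ^ 2) + |lam k i - ls i| * M i) *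
        t k ^ 2 = (m + C * (lam k i + ls i)) * μ k + |lam k i - ls i| * M i * t k ^ 2 :=
      fun i => by field_simp
    have e3 : n * C * (μ k / t k) * t k ^ 2 = n * (C * μ k * t k) := by field_simp
    simp only [mul_assoc (lam k _), e1, e2, e3, sub_dotProduct]
    simp only [mul_sub, sub_mul, Finset.sum_sub_distrib, Finset.sum_neg_distrib] at hsum ⊢
    have hL : P.gradphi (z k) ⬝ᵥ (z k - zstar) +
      ∑ i, lam k i * (P.gradg i (z k) ⬝ᵥ (z k - zstar)) ≤ n * (C * μ k * t k) := hL
    linarith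
  have hsq : 0 < evnorm d ^ 2 := by
    have : d ≠ 0 := fun h => by simp [h] at hd1
    obtain ⟨i, hi⟩ := Function.ne_iff.1 this
    have := (abs_pos.2 hi).trans_le (abs_le_evnorm d i)
    positivity
  have hquad_ge' : ξ * evnorm d ^ 2 ≤ d ⬝ᵥ (P.Lzz zstar ls) *ᵥ d := hquad_ge
  nlinarith [mul_pos hξ hsq]

lemma eventually_norm_sub_le_sqrt_dmu {zstar : Fin n → ℝ} {ls : Fin m → ℝ}
    (hls : ls ∈ P.Slam zstar) (hsoc : P.SOC zstar) (C gam : ℝ) :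
    ∃ K : ℝ, 0 ≤ K ∧ ∀ᶠ x in 𝓝 (zstar, ls), ∀ s, P.central C gam x.1 x.2 s →
      ‖x.1 - zstar‖ ≤ K * √(dmu x.2 s) := by
  by_contra! h
  have hex : ∀ k : ℕ, ∃ x : (Fin n → ℝ) × (Fin m → ℝ), ∃ s, dist x (zstar, ls) < 1 / (k + 1) ∧
      P.central C gam x.1 x.2 s ∧ (k + 1) * √(dmu x.2 s) < ‖x.1 - zstar‖ := fun k => by
    obtain ⟨x, ⟨s, hs⟩, hx⟩ := ((h (k + 1) (by positivity)).and_eventually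
      (Metric.ball_mem_nhds (zstar, ls) (Nat.one_div_pos_of_nat (n := k)))).exists
    exact ⟨x, s, hx, hs⟩
  choose x s hdist hcen hlt using hex
  have hpos : ∀ k, 0 < ‖(x k).1 - zstar‖ := fun k => lt_of_le_of_lt (by positivity) (hlt k)
  have hx : Tendsto x atTop (𝓝 (zstar, ls)) := by
    rw [tendsto_iff_dist_tendsto_zero]
    exact squeeze_zero (fun _ => dist_nonneg) (fun k => (hdist k).le)
      tendsto_one_div_add_atTop_nhds_zero_nat
  have hmu : Tendsto (fun k => √(dmu (x k).2 (s k)) / ‖(x k).1 - zstar‖) atTop (𝓝 0) := by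
    refine squeeze_zero (fun _ => by positivity) (fun k => ?_)
      tendsto_one_div_add_atTop_nhds_zero_nat
    rw [div_le_div_iff₀ (hpos k) (by positivity)]
    linarith [hlt k]
  obtain ⟨d, -, φ, hφ, hd⟩ := (isCompact_sphere (0 : Fin n → ℝ) 1).tendsto_subseq
    (x := fun k => ‖(x k).1 - zstar‖⁻¹ • ((x k).1 - zstar)) fun k => by
      rw [mem_sphere_zero_iff_norm, norm_smul, norm_inv, norm_norm,
        inv_mul_cancel₀ (hpos k).ne']
  have hxφ := hx.comp hφ.tendsto_atTop
  exact false_of_central_seq hls hsoc (z := fun k => (x (φ k)).1) (lam := fun k => (x (φ k)).2)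
    (s := fun k => s (φ k)) ((continuous_fst.tendsto _).comp hxφ)
    ((continuous_snd.tendsto _).comp hxφ) (fun k => hcen _) (fun k => hpos _) hd
    (hmu.comp hφ.tendsto_atTop)

lemma delta_le {zstar z : Fin n → ℝ} {lam q : Fin m → ℝ} (hq : q ∈ P.Slam zstar) :
    P.delta zstar z lam ≤ √n * ‖z - zstar‖ + √m * ‖lam - q‖ := by
  have hz := evnorm_le_sqrt_card_mul_norm (z - zstar)
  have hlam := evnorm_le_sqrt_card_mul_norm (lam - q)
  rw [Fintype.card_fin] at hz hlam
  have hle : P.delta zstar z lam ≤ √(evnorm (z - zstar) ^ 2 + evnorm (lam - q) ^ 2) := by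
    refine csInf_le ⟨0, ?_⟩ ⟨q, hq, rfl⟩
    rintro _ ⟨_, _, rfl⟩
    exact Real.sqrt_nonneg _
  refine hle.trans (le_trans ?_ (add_le_add hz hlam))
  · have h1 : 0 ≤ evnorm (z - zstar) := Real.sqrt_nonneg _
    have h2 : 0 ≤ evnorm (lam - q) := Real.sqrt_nonneg _
    refine Real.sqrt_le_iff.2 ⟨by positivity, ?_⟩
    nlinarith

variable (P) in
/-- The linear part of the equations defining the multiplier set at `z`. -/
def multiplierMap (z : Fin n → ℝ) : (Fin m → ℝ) →L[ℝ] (Fin n → ℝ) × ℝ :=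
  ∑ i, (ContinuousLinearMap.proj (R := ℝ) (φ := fun _ : Fin m => ℝ) i).smulRight
    (P.gradg i z, P.g i z)

lemma multiplierMap_sub_eq (z : Fin n → ℝ) (lam : Fin m → ℝ) :
    P.multiplierMap z lam - (-P.gradphi z, 0) = (P.Lz z lam, ∑ i, lam i * P.g i z) := by
  ext j
  · simp [multiplierMap, Lz, Prod.fst_sum, add_comm]
  · simp [multiplierMap, Prod.snd_sum]

lemma mem_Slam_iff {zstar : Fin n → ℝ} (hfeas : ∀ i, P.g i zstar ≤ 0) (lam : Fin m → ℝ) :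
    lam ∈ P.Slam zstar ↔
      (∀ i, 0 ≤ lam i) ∧ P.multiplierMap zstar lam = (-P.gradphi zstar, 0) := by
  rw [← sub_eq_zero, multiplierMap_sub_eq, Prod.mk_eq_zero]
  exact ⟨fun h => ⟨h.2.2.1, h.1, h.2.2.2⟩, fun h => ⟨h.2.1, hfeas, h.1, h.2.2⟩⟩

lemma exists_dist_Slam_le {zstar : Fin n → ℝ} (hfeas : ∀ i, P.g i zstar ≤ 0)
    (hne : (P.Slam zstar).Nonempty) :
    ∃ K : ℝ, 0 ≤ K ∧ ∀ lam : Fin m → ℝ, (∀ i, 0 ≤ lam i) → ∃ q ∈ P.Slam zstar,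
      ‖lam - q‖ ≤ K * ‖(P.Lz zstar lam, ∑ i, lam i * P.g i zstar)‖ := by
  obtain ⟨q₀, hq₀⟩ := hne
  obtain ⟨K, hK, h⟩ := hoffman_standard_form (P.multiplierMap zstar) (-P.gradphi zstar, 0)
    ⟨q₀, (mem_Slam_iff hfeas q₀).1 hq₀⟩
  refine ⟨K, hK, fun lam hlam => ?_⟩
  obtain ⟨q, hq0, hq, hb⟩ := h lam hlam
  rw [multiplierMap_sub_eq] at hb
  exact ⟨q, (mem_Slam_iff hfeas q).2 ⟨hq0, hq⟩, hb⟩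

lemma isBigO_smul_sub {F : Type*} [NormedAddCommGroup F] [NormedSpace ℝ F]
    {f : (Fin n → ℝ) → F} {f' : (Fin n → ℝ) →L[ℝ] F} {a : Fin n → ℝ}
    (hf : HasFDerivAt f f' a) (ls : Fin m → ℝ) (i : Fin m) :
    (fun x : (Fin n → ℝ) × (Fin m → ℝ) => x.2 i • (f x.1 - f a)) =O[𝓝 (a, ls)]
      fun x => x.1 - a := by
  have h1 : (fun x : (Fin n → ℝ) × (Fin m → ℝ) => x.2 i) =O[𝓝 (a, ls)] fun _ => (1 : ℝ) :=
    ((by fun_prop : Continuous fun x : (Fin n → ℝ) × (Fin m → ℝ) => x.2 i).tendsto _).isBigO_one ℝ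
  have h2 := hf.isBigO_sub.comp_tendsto (continuous_fst.tendsto (a, ls))
  have h3 := h1.smul h2.norm_right
  simp only [smul_eq_mul, one_mul] at h3
  exact h3.of_norm_right

variable (P) in
lemma isBigO_residual_sub (zstar : Fin n → ℝ) (ls : Fin m → ℝ) :
    (fun x : (Fin n → ℝ) × (Fin m → ℝ) =>
      ((P.Lz x.1 x.2, ∑ i, x.2 i * P.g i x.1) : (Fin n → ℝ) × ℝ) -
        (P.Lz zstar x.2, ∑ i, x.2 i * P.g i zstar)) =O[𝓝 (zstar, ls)]
      fun x => x.1 - zstar := by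
  have h1 := (P.hess_phi zstar).isBigO_sub.comp_tendsto (continuous_fst.tendsto (zstar, ls))
  have h2 := Asymptotics.IsBigO.sum (s := Finset.univ) fun i _ =>
    isBigO_smul_sub (P.hess_g i zstar) ls i
  have h3 := Asymptotics.IsBigO.sum (s := Finset.univ) fun i _ =>
    isBigO_smul_sub (P.grad_g i zstar) ls i
  refine ((h1.add h2).prod_left h3).congr_left fun x => ?_
  ext j
  · simp only [Lz, Pi.add_apply, Pi.sub_apply, Function.comp_apply, Finset.sum_apply,
      Pi.smul_apply, smul_eq_mul, mul_sub, Finset.sum_sub_distrib, Prod.fst_sub]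
    ring
  · simp [mul_sub, Finset.sum_sub_distrib]

lemma central.norm_residual_le {C gam B : ℝ} {z : Fin n → ℝ} {lam s : Fin m → ℝ} (hC : 0 ≤ C)
    (h : P.central C gam z lam s) (hB : ‖lam‖ ≤ B) :
    ‖((P.Lz z lam, ∑ i, lam i * P.g i z) : (Fin n → ℝ) × ℝ)‖ ≤
      (C + m * (B * C) + m) * dmu lam s := by
  have hμ := h.dmu_nonneg
  have hB0 : 0 ≤ B := (norm_nonneg _).trans hB
  refine norm_prod_le_iff.2 ⟨?_, ?_⟩
  · have hL : ‖P.Lz z lam‖ ≤ C * dmu lam s :=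
      (pi_norm_le_iff_of_nonneg (by positivity)).2 h.abs_Lz_le
    have : 0 ≤ (m * (B * C) + m) * dmu lam s := by positivity
    linarith
  · have hdot := abs_dotProduct_le lam (fun i => P.g i z + s i)
      (fun i => (norm_le_pi_norm lam i).trans hB) h.abs_g_add_le
    have hsplit : lam ⬝ᵥ (fun i => P.g i z + s i) =
        ∑ i, lam i * P.g i z + m * dmu lam s := by
      rw [← sum_mul_eq_card_mul_dmu, ← Finset.sum_add_distrib]
      exact Finset.sum_congr rfl fun i _ => mul_add _ _ _
    rw [hsplit] at hdot
    have hm : 0 ≤ m * dmu lam s := by positivity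
    have hCμ : 0 ≤ C * dmu lam s := by positivity
    obtain ⟨h1, h2⟩ := abs_le.1 hdot
    exact abs_le.2 ⟨by linarith, by linarith⟩

lemma eventually_delta_le_sqrt_dmu {zstar : Fin n → ℝ} {ls : Fin m → ℝ}
    (hls : ls ∈ P.Slam zstar) (hsoc : P.SOC zstar) {C : ℝ} (hC : 0 ≤ C) (gam : ℝ) :
    ∃ K : ℝ, 0 < K ∧ ∀ᶠ x in 𝓝 (zstar, ls), ∀ s, P.central C gam x.1 x.2 s →
      P.delta zstar x.1 x.2 ≤ K * √(dmu x.2 s) := by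
  obtain ⟨K₁, hK₁, hz⟩ := eventually_norm_sub_le_sqrt_dmu hls hsoc C gam
  obtain ⟨K₂, hK₂, hhoff⟩ := exists_dist_Slam_le hls.2.1 ⟨ls, hls⟩
  obtain ⟨c, hc, hres⟩ := (P.isBigO_residual_sub zstar ls).exists_pos
  set D : ℝ := C + m * ((‖ls‖ + 1) * C) + m with hD
  have hD0 : 0 ≤ D := by positivity
  set K : ℝ := √n * K₁ + √m * (K₂ * (c * K₁ + D)) with hK
  have hK0 : 0 ≤ K := by positivity
  refine ⟨K + √n + √m + 1, by positivity, ?_⟩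
  filter_upwards [hz, hres.bound, Metric.closedBall_mem_nhds (zstar, ls) one_pos]
    with x hzx hresx hx s hcen
  rw [mem_closedBall_iff_norm, norm_prod_le_iff] at hx
  obtain ⟨hx1, hx2⟩ := hx
  simp only [Prod.fst_sub, Prod.snd_sub] at hx1 hx2
  have hμ := hcen.dmu_nonneg
  set r := √(dmu x.2 s) with hr
  have hr0 : 0 ≤ r := Real.sqrt_nonneg _
  have hr2 : dmu x.2 s = r ^ 2 := (Real.sq_sqrt hμ).symm
  rcases le_total r 1 with hr1 | hr1
  · obtain ⟨q, hq, hb⟩ := hhoff x.2 fun i => (hcen.2.2.1 i).le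
    have hlam : ‖x.2‖ ≤ ‖ls‖ + 1 := by
      have := norm_le_norm_add_norm_sub' x.2 ls
      linarith
    have hzr := hzx s hcen
    have hR : ‖((P.Lz zstar x.2, ∑ i, x.2 i * P.g i zstar) : (Fin n → ℝ) × ℝ)‖ ≤
        (c * K₁ + D) * r := by
      have h1 := hcen.norm_residual_le hC hlam
      have h2 := norm_le_norm_add_norm_sub
        ((P.Lz x.1 x.2, ∑ i, x.2 i * P.g i x.1) : (Fin n → ℝ) × ℝ)
        (P.Lz zstar x.2, ∑ i, x.2 i * P.g i zstar)
      have h3 : c * ‖x.1 - zstar‖ ≤ c * (K₁ * r) := by gcongr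
      have h4 : D * dmu x.2 s ≤ D * r := by
        rw [hr2]
        gcongr
        nlinarith
      linarith
    calc P.delta zstar x.1 x.2 ≤ √n * ‖x.1 - zstar‖ + √m * ‖x.2 - q‖ := delta_le hq
      _ ≤ √n * (K₁ * r) + √m * (K₂ * ((c * K₁ + D) * r)) := by
        gcongr
        exact hb.trans (by gcongr)
      _ = K * r := by rw [hK]; ring
      _ ≤ (K + √n + √m + 1) * r := by
        gcongr
        have h1 := Real.sqrt_nonneg n
        have h2 := Real.sqrt_nonneg m
        linarith
  · calc P.delta zstar x.1 x.2 ≤ √n * ‖x.1 - zstar‖ + √m * ‖x.2 - ls‖ := delta_le hls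
      _ ≤ √n * 1 + √m * 1 := by gcongr
      _ ≤ (K + √n + √m + 1) * 1 := by linarith
      _ ≤ (K + √n + √m + 1) * r := by gcongr

lemma isCompact_Slam {zstar : Fin n → ℝ} (hfeas : ∀ i, P.g i zstar ≤ 0)
    (hmfcq : P.MFCQ zstar) : IsCompact (P.Slam zstar) := by
  obtain ⟨y, hy⟩ := hmfcq
  have hy : ∀ i, P.g i zstar = 0 → P.gradg i zstar ⬝ᵥ y < 0 := hy
  have hclosed : IsClosed (P.Slam zstar) := by
    have : P.Slam zstar = (⋂ i, {lam | 0 ≤ lam i}) ∩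
        {lam | P.multiplierMap zstar lam = (-P.gradphi zstar, 0)} := by
      ext lam
      simp [mem_Slam_iff hfeas]
    rw [this]
    exact (isClosed_iInter fun i => isClosed_le continuous_const (continuous_apply i)).inter
      (isClosed_eq (P.multiplierMap zstar).continuous continuous_const)
  refine (isCompact_Icc (a := (0 : Fin m → ℝ))
    (b := fun i => |P.gradphi zstar ⬝ᵥ y / -(P.gradg i zstar ⬝ᵥ y)|)).of_isClosed_subset
    hclosed fun lam hlam => ?_
  have hlam : P.KKT zstar lam := hlam
  refine ⟨hlam.2.2.1, fun i => ?_⟩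
  rcases mul_eq_zero.1 (hlam.mul_eq_zero i) with h0 | hi
  · exact h0.trans_le (abs_nonneg _)
  · refine le_trans ?_ (le_abs_self _)
    rw [le_div_iff₀ (neg_pos.2 (hy i hi))]
    have hsum := P.Lz_dotProduct zstar lam y
    rw [hlam.1, zero_dotProduct] at hsum
    have hle : ∑ j, lam j * (P.gradg j zstar ⬝ᵥ y) ≤ lam i * (P.gradg i zstar ⬝ᵥ y) := by
      rw [← Finset.add_sum_erase _ _ (Finset.mem_univ i)]
      refine add_le_of_nonpos_right (Finset.sum_nonpos fun j _ => ?_)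
      rcases mul_eq_zero.1 (hlam.mul_eq_zero j) with h0 | hj
      · rw [h0, zero_mul]
      · exact mul_nonpos_of_nonneg_of_nonpos (hlam.2.2.1 j) (hy j hj).le
    linarith

end NLP

end ErrorBound

/-- Suppose `z*` is a solution of the nonlinear program at which MFCQ
and the second-order condition are satisfied, and fix `C > 0`, `γ ∈ (0,1)`.  Then
there exist `K > 0` and a neighborhood `W` of `S` such that every triple `(z,λ,s)`
with `(z,λ) ∈ W`, `λ ≥ 0`, satisfying the approximate centrality conditions with
constants `C`, `γ`, has `δ(z,λ) ≤ K·μ^{1/2}` with `μ = λᵀs/m`. -/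
theorem stmt2_delta_le_sqrt_mu
    {n m : ℕ} (P : NLP n m) (zstar : Fin n → ℝ)
    (hsol : P.isSolution zstar)
    (hmfcq : P.MFCQ zstar)
    (hsoc : P.SOC zstar)
    (C gam : ℝ) (hC : 0 < C) (hgam0 : 0 < gam) (hgam1 : gam < 1) :
    ∃ K : ℝ, 0 < K ∧
      ∃ W : Set ((Fin n → ℝ) × (Fin m → ℝ)), IsOpen W ∧
        (∀ ls ∈ P.Slam zstar, (zstar, ls) ∈ W) ∧
        ∀ z : Fin n → ℝ, ∀ lam s : Fin m → ℝ,
          (z, lam) ∈ W → (∀ i, 0 ≤ lam i) → P.central C gam z lam s →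
          P.delta zstar z lam ≤ K * Real.sqrt (dmu lam s) := by
  obtain ⟨hfeas, -, -⟩ := hsol
  obtain ⟨K, hK, W, hW, hSW, hb⟩ := ((isCompact_singleton (x := zstar)).prod
    (NLP.isCompact_Slam hfeas hmfcq)).induction_on
    (p := fun T => ∃ K : ℝ, 0 < K ∧ ∃ W : Set ((Fin n → ℝ) × (Fin m → ℝ)), IsOpen W ∧ T ⊆ W ∧
      ∀ x ∈ W, ∀ s, P.central C gam x.1 x.2 s →
        P.delta zstar x.1 x.2 ≤ K * Real.sqrt (dmu x.2 s))
    ⟨1, one_pos, ∅, isOpen_empty, Set.Subset.rfl, fun x hx => hx.elim⟩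
    (fun S T hST ⟨K, hK, W, hW, hTW, hb⟩ => ⟨K, hK, W, hW, hST.trans hTW, hb⟩)
    (fun S T ⟨K, hK, W, hW, hSW, hb⟩ ⟨K', hK', W', hW', hTW', hb'⟩ =>
      ⟨max K K', lt_max_of_lt_left hK, W ∪ W', hW.union hW', Set.union_subset_union hSW hTW',
        fun x hx s hs => hx.elim
          (fun hx => (hb x hx s hs).trans
            (mul_le_mul_of_nonneg_right (le_max_left _ _) (Real.sqrt_nonneg _)))
          (fun hx => (hb' x hx s hs).trans
            (mul_le_mul_of_nonneg_right (le_max_right _ _) (Real.sqrt_nonneg _)))⟩)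
    (fun x hx => by
      obtain ⟨K, hK, hev⟩ := NLP.eventually_delta_le_sqrt_dmu hx.2 hsoc hC.le gam
      obtain ⟨W, hW, hWopen, hxW⟩ := eventually_nhds_iff.1 hev
      have hx' : x = (zstar, x.2) := Prod.ext hx.1 rfl
      exact ⟨W, mem_nhdsWithin_of_mem_nhds (hWopen.mem_nhds (hx' ▸ hxW)),
        K, hK, W, hWopen, Set.Subset.rfl, hW⟩)
  exact ⟨K, hK, W, hW, fun ls hls => hSW ⟨rfl, hls⟩, fun z lam s hx _ hs => hb (z, lam) hx s hs⟩
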